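/- Let φ be an unsatisfiable linear r-CNF formula. If there exists a (k + r − 1)-winning strategy for φ, then Space(φ) ≥ k − 1. -/

import Mathlib

open Finset

/-- The two-element field. -/
abbrev F2 : Type := ZMod 2

/-- An `F2`-linear form in the variables `V`, given by its coefficients. -/
abbrev LinForm (V : Type) : Type := V → F2

/-- A linear literal: an equation `f = a` where `f` is a linear form and `a ∈ F2`. -/
abbrev LinLit (V : Type) : Type := LinForm V × F2

/-- A linear clause: a finite disjunction of linear literals. -/
abbrev LinClause (V : Type) : Type := Finset (LinLit V)

/-- A linear system: a finite conjunction of linear equations. -/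
abbrev LinSystem (V : Type) : Type := Finset (LinLit V)

/-- A linear CNF formula: a conjunction of linear clauses. -/
abbrev LinCNF (V : Type) : Type := Set (LinClause V)

variable {V : Type}

/-- Evaluation of a linear form at an assignment. -/
def evalForm [Fintype V] (f : LinForm V) (σ : V → F2) : F2 := ∑ v, f v * σ v

/-- The assignment `σ` satisfies the linear equation `l.1 = l.2`. -/
def LitSat [Fintype V] (σ : V → F2) (l : LinLit V) : Prop := evalForm l.1 σ = l.2

/-- The assignment `σ` satisfies the linear clause `C` (some literal of `C` holds). -/
def ClauseSat [Fintype V] (σ : V → F2) (C : LinClause V) : Prop := ∃ l ∈ C, LitSat σ l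

/-- The assignment `σ` is a solution of the linear system `S` (all equations hold). -/
def SysSat [Fintype V] (σ : V → F2) (S : LinSystem V) : Prop := ∀ l ∈ S, LitSat σ l

/-- The assignment `σ` satisfies the linear CNF `φ`. -/
def CNFSat [Fintype V] (σ : V → F2) (φ : LinCNF V) : Prop := ∀ C ∈ φ, ClauseSat σ C

/-- The linear CNF `φ` is unsatisfiable. -/
def Unsat [Fintype V] (φ : LinCNF V) : Prop := ¬ ∃ σ, CNFSat σ φ

/-- The positive literal `v = 1` for a single variable `v`. -/
def posLit [DecidableEq V] (v : V) : LinLit V := (Pi.single v 1, 1)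

/-- The negative literal `v = 0` for a single variable `v`. -/
def negLit [DecidableEq V] (v : V) : LinLit V := (Pi.single v 1, 0)

/-- A solution is `F`-proper if it satisfies every clause of `F`. -/
def FProper [Fintype V] (F : Set (LinClause V)) (σ : V → F2) : Prop := ∀ C ∈ F, ClauseSat σ C

/-- `φ` is `m`-extensible w.r.t. `F`: every linear system with fewer than `m` equations
that has an `F`-proper solution has, for each clause `C ∈ φ \ F`, an `F`-proper solution
satisfying `C`. -/
def Extensible [Fintype V] (φ : LinCNF V) (F : Set (LinClause V)) (m : ℕ) : Prop :=
  ∀ S : LinSystem V, S.card < m → (∃ σ, SysSat σ S ∧ FProper F σ) →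
    ∀ C ∈ φ \ F, ∃ τ, SysSat τ S ∧ FProper F τ ∧ ClauseSat τ C

/-- A configuration: a finite set of linear clauses kept in memory. -/
abbrev Config (V : Type) : Type := Finset (LinClause V)

/-- Semantic inference: `C` follows from clauses in `S` by the resolution rule or the
semantic weakening rule. -/
def InferSem [Fintype V] [DecidableEq V] (S : Config V) (C : LinClause V) : Prop :=
  (∃ (f : LinForm V) (A B : LinClause V),
      insert (f, (0 : F2)) A ∈ S ∧ insert (f, (1 : F2)) B ∈ S ∧ C = A ∪ B) ∨
  (∃ D ∈ S, ∀ σ, ClauseSat σ D → ClauseSat σ C)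

/-- The identically zero linear form. -/
def zeroForm (V : Type) : LinForm V := fun _ => 0

/-- Syntactic inference: `C` follows from clauses in `S` by the resolution rule,
the simplification rule, the syntactic weakening rule, or the addition rule. -/
def InferSyn [Fintype V] [DecidableEq V] (S : Config V) (C : LinClause V) : Prop :=
  (∃ (f : LinForm V) (A B : LinClause V),
      insert (f, (0 : F2)) A ∈ S ∧ insert (f, (1 : F2)) B ∈ S ∧ C = A ∪ B) ∨
  (insert ((zeroForm V, (1 : F2)) : LinLit V) C ∈ S) ∨
  (∃ (D : LinClause V) (f : LinForm V) (α : F2), D ∈ S ∧ C = insert (f, α) D) ∨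
  (∃ (D : LinClause V) (f₁ f₂ : LinForm V) (α₁ α₂ : F2),
      insert (f₁, α₁) (insert (f₂, α₂) D) ∈ S ∧
      C = insert (f₁, α₁) (insert (f₁ + f₂, α₁ + α₂ + 1) D))

/-- One step of a configuration-style refutation: download a clause of `φ`,
erase a clause, or add a clause inferred (via `Inf`) from the current configuration. -/
inductive ConfigStep [Fintype V] [DecidableEq V] (φ : LinCNF V)
    (Inf : Config V → LinClause V → Prop) : Config V → Config V → Prop
  | download {S : Config V} {C : LinClause V} (h : C ∈ φ) : ConfigStep φ Inf S (insert C S)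
  | erase {S : Config V} {C : LinClause V} (h : C ∈ S) : ConfigStep φ Inf S (S.erase C)
  | infer {S : Config V} {C : LinClause V} (h : Inf S C) : ConfigStep φ Inf S (insert C S)

/-- A configuration-style Res(⊕) refutation of `φ` with inference rules `Inf`:
a sequence of configurations starting from the empty configuration, each obtained from
the previous one by a basic step, ending with a configuration containing the empty
clause. -/
def IsConfigRefutation [Fintype V] [DecidableEq V] (φ : LinCNF V)
    (Inf : Config V → LinClause V → Prop) (π : List (Config V)) : Prop :=
  π.head? = some (∅ : Config V) ∧ List.Chain' (ConfigStep φ Inf) π ∧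
    ∃ S : Config V, π.getLast? = some S ∧ (∅ : LinClause V) ∈ S

/-- The space of a sequence of configurations: the maximum number of clauses in memory. -/
def spaceOf (π : List (Config V)) : ℕ := (π.map Finset.card).foldr max 0

/-- A `k`-winning strategy for the linear CNF `φ`: a nonempty family `H` of linear systems
such that (1) each member has at most `k` equations; (2) each member has, for every clause
`C` of `φ`, a solution satisfying `C`; (3) `H` is closed under semantically implied systems
with at most `k` equations; (4) each member with fewer than `k` equations can be extended
by `f = a` for some `a ∈ F2` while remaining in `H`. -/
def IsWinningStrategy [Fintype V] [DecidableEq V] (φ : LinCNF V) (k : ℕ)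
    (H : Set (LinSystem V)) : Prop :=
  H.Nonempty ∧
  (∀ F ∈ H, F.card ≤ k) ∧
  (∀ F ∈ H, ∀ C ∈ φ, ∃ σ, SysSat σ F ∧ ClauseSat σ C) ∧
  (∀ F ∈ H, ∀ G : LinSystem V, G.card ≤ k → (∀ σ, SysSat σ F → SysSat σ G) → G ∈ H) ∧
  (∀ F ∈ H, F.card < k → ∀ f : LinForm V, ∃ a : F2, insert ((f, a) : LinLit V) F ∈ H)

theorem evalForm_add_right [Fintype V] (f : LinForm V) (σ τ : V → F2) :
    evalForm f (σ + τ) = evalForm f σ + evalForm f τ := by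
  simp [evalForm, mul_add, Finset.sum_add_distrib]

theorem evalForm_add_left [Fintype V] (f g : LinForm V) (σ : V → F2) :
    evalForm (f + g) σ = evalForm f σ + evalForm g σ := by
  simp [evalForm, add_mul, Finset.sum_add_distrib]

/-- The solution set of a linear system over `F2` is closed under sums of three solutions. -/
theorem SysSat.add_add [Fintype V] {F : LinSystem V} {σ τ ρ : V → F2} (hσ : SysSat σ F)
    (hτ : SysSat τ F) (hρ : SysSat ρ F) : SysSat (σ + τ + ρ) F := by
  intro l hl
  have h₁ := hσ l hl
  have h₂ := hτ l hl
  have h₃ := hρ l hl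
  unfold LitSat at *
  rw [evalForm_add_right, evalForm_add_right, h₁, h₂, h₃]
  generalize l.2 = a
  revert a
  decide

/-- If a linear system implies a linear clause, then some single linear equation
interpolates between them. -/
theorem exists_interpolating_equation [Fintype V] [DecidableEq V] (D : LinClause V) :
    ∀ F : LinSystem V, (∀ σ, SysSat σ F → ClauseSat σ D) →
      ∃ l : LinLit V, (∀ σ, SysSat σ F → LitSat σ l) ∧ ∀ σ, LitSat σ l → ClauseSat σ D := by
  induction D using Finset.induction_on with
  | empty =>
    intro F hF
    refine ⟨(0, 1), fun σ hσ => ?_, fun σ hσ => ?_⟩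
    · obtain ⟨l, hl, -⟩ := hF σ hσ
      simp at hl
    · simp [LitSat, evalForm] at hσ
  | insert p D _ ih =>
    obtain ⟨f, a⟩ := p
    intro F hF
    obtain ⟨⟨g, b⟩, hFg, hgD⟩ := ih (insert (f, a + 1) F) (by
      intro σ hσ
      obtain ⟨l, hl, hls⟩ := hF σ fun l hl => hσ l (Finset.mem_insert_of_mem hl)
      rcases Finset.mem_insert.1 hl with rfl | hl
      · have h := hσ (f, a + 1) (Finset.mem_insert_self _ _)
        simp only [LitSat] at h hls
        simp [h] at hls
      · exact ⟨l, hl, hls⟩)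
    have hF_imp : ∀ σ, SysSat σ F → evalForm f σ = a + 1 → evalForm g σ = b := by
      intro σ hσ hf
      refine hFg σ fun l hl => ?_
      rcases Finset.mem_insert.1 hl with rfl | hl
      · exact hf
      · exact hσ l hl
    have hf_imp : ∀ σ, evalForm f σ = a → ClauseSat σ (insert (f, a) D) :=
      fun σ h => ⟨(f, a), Finset.mem_insert_self _ _, h⟩
    have hg_imp : ∀ σ, evalForm g σ = b → ClauseSat σ (insert (f, a) D) := by
      intro σ h
      obtain ⟨l, hl, hls⟩ := hgD σ h
      exact ⟨l, Finset.mem_insert_of_mem hl, hls⟩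
    have eq_of_ne : ∀ x y : F2, x ≠ y → x = y + 1 := by decide
    by_cases hg : ∀ σ, SysSat σ F → evalForm g σ = b
    · exact ⟨(g, b), hg, hg_imp⟩
    by_cases hf : ∀ σ, SysSat σ F → evalForm f σ = a
    · exact ⟨(f, a), hf, hf_imp⟩
    push Not at hg hf
    obtain ⟨σ, hσ, hgσ⟩ := hg
    obtain ⟨τ, hτ, hfτ⟩ := hf
    have hfσ : evalForm f σ = a := by
      by_contra h
      exact hgσ (hF_imp σ hσ (eq_of_ne _ _ h))
    have hfτ' := eq_of_ne _ _ hfτ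
    have hgτ := hF_imp τ hτ hfτ'
    have hgσ' := eq_of_ne _ _ hgσ
    refine ⟨(f + g, a + b + 1), fun ρ hρ => ?_, fun ρ hρ => ?_⟩
    · have h := hF_imp _ ((hσ.add_add hτ) hρ)
      have h' := hF_imp ρ hρ
      simp only [LitSat, evalForm_add_right, evalForm_add_left, hfσ, hfτ', hgτ, hgσ'] at h h' ⊢
      generalize evalForm f ρ = x at *
      generalize evalForm g ρ = y at *
      clear * - h h'
      revert a b x y
      decide
    · by_cases hfρ : evalForm f ρ = a
      · exact hf_imp ρ hfρ
      · refine hg_imp ρ ?_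
        have hfρ' := eq_of_ne _ _ hfρ
        simp only [LitSat, evalForm_add_left, hfρ'] at hρ
        generalize evalForm g ρ = y at *
        clear * - hρ
        revert a b y
        decide

/-- A member of a winning strategy can be extended, inside the strategy, so as to decide all
forms in a given finite set. -/
theorem IsWinningStrategy.exists_deciding [Fintype V] [DecidableEq V] {φ : LinCNF V} {k : ℕ}
    {H : Set (LinSystem V)} (hH : IsWinningStrategy φ k H) {F : LinSystem V} (hF : F ∈ H)
    (T : LinClause V) :
    F.card + T.card ≤ k → ∃ G ∈ H, F ⊆ G ∧ G.card ≤ F.card + T.card ∧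
      ∀ l ∈ T, ∃ a : F2, (l.1, a) ∈ G := by
  induction T using Finset.induction_on with
  | empty => exact fun _ => ⟨F, hF, subset_rfl, by simp, by simp⟩
  | insert p T hp ih =>
    rw [Finset.card_insert_of_notMem hp]
    intro hk
    obtain ⟨G, hG, hFG, hcard, hdec⟩ := ih (by omega)
    obtain ⟨a, ha⟩ := hH.2.2.2.2 G hG (by omega) p.1
    refine ⟨_, ha, hFG.trans (Finset.subset_insert _ _), ?_, fun l hl => ?_⟩
    · have := Finset.card_insert_le (p.1, a) G
      omega
    · rcases Finset.mem_insert.1 hl with rfl | hl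
      · exact ⟨a, Finset.mem_insert_self _ _⟩
      · obtain ⟨b, hb⟩ := hdec l hl
        exact ⟨b, Finset.mem_insert_of_mem hb⟩

/-- A clause derivable from `S` is satisfied whenever all clauses of `S` are. -/
theorem InferSem.sound [Fintype V] [DecidableEq V] {S : Config V} {C : LinClause V}
    (h : InferSem S C) {σ : V → F2} (hσ : ∀ D ∈ S, ClauseSat σ D) : ClauseSat σ C := by
  rcases h with ⟨f, A, B, hA, hB, rfl⟩ | ⟨D, hD, hDC⟩
  · obtain ⟨l, hl, hls⟩ := hσ _ hA
    obtain ⟨m, hm, hms⟩ := hσ _ hB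
    rcases Finset.mem_insert.1 hl with rfl | hl
    · rcases Finset.mem_insert.1 hm with rfl | hm
      · simp only [LitSat] at hls hms
        simp [hls] at hms
      · exact ⟨m, Finset.mem_union_right _ hm, hms⟩
    · exact ⟨l, Finset.mem_union_left _ hl, hls⟩
  · exact hDC σ (hσ D hD)

/-- `S` is controlled by `H` if some system in `H` with at most `|S|` equations implies every
clause of `S`. -/
def Controlled [Fintype V] (H : Set (LinSystem V)) (S : Config V) : Prop :=
  ∃ F ∈ H, F.card ≤ S.card ∧ ∀ σ, SysSat σ F → ∀ D ∈ S, ClauseSat σ D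

theorem IsWinningStrategy.controlled_of_implies [Fintype V] [DecidableEq V] {φ : LinCNF V}
    {k : ℕ} {H : Set (LinSystem V)} (hH : IsWinningStrategy φ k H) {F : LinSystem V} (hF : F ∈ H)
    {S : Config V} (hS : S.card ≤ k) (himp : ∀ σ, SysSat σ F → ∀ D ∈ S, ClauseSat σ D) :
    Controlled H S := by
  have hex : ∀ D : LinClause V, ∃ l : LinLit V, D ∈ S →
      (∀ σ, SysSat σ F → LitSat σ l) ∧ ∀ σ, LitSat σ l → ClauseSat σ D := by
    intro D
    by_cases hD : D ∈ S
    · obtain ⟨l, hl⟩ := exists_interpolating_equation D F fun σ hσ => himp σ hσ D hD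
      exact ⟨l, fun _ => hl⟩
    · exact ⟨(0, 0), fun h => absurd h hD⟩
  choose l hl using hex
  refine ⟨S.image l, hH.2.2.2.1 F hF _ (Finset.card_image_le.trans hS) ?_,
    Finset.card_image_le, fun σ hσ D hD => ?_⟩
  · intro σ hσ m hm
    obtain ⟨D, hD, rfl⟩ := Finset.mem_image.1 hm
    exact (hl D hD).1 σ hσ
  · exact (hl D hD).2 σ (hσ _ (Finset.mem_image_of_mem l hD))

theorem IsWinningStrategy.controlled_step [Fintype V] [DecidableEq V] {φ : LinCNF V} {r k : ℕ}
    (hr : ∀ C ∈ φ, C.card ≤ r) {H : Set (LinSystem V)} (hH : IsWinningStrategy φ (k + r) H)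
    {S T : Config V} (hS : S.card ≤ k) (hT : T.card ≤ k) (hstep : ConfigStep φ InferSem S T)
    (hcon : Controlled H S) : Controlled H T := by
  obtain ⟨F, hF, hcard, himp⟩ := hcon
  cases hstep with
  | @download C hC =>
    have hCr := hr C hC
    obtain ⟨G, hG, hFG, -, hdec⟩ := hH.exists_deciding hF C (by omega)
    obtain ⟨τ, hτ, l, hl, hlτ⟩ := hH.2.2.1 G hG C hC
    obtain ⟨a, ha⟩ := hdec l hl
    have hal : a = l.2 := (hτ _ ha).symm.trans hlτ
    refine hH.controlled_of_implies hG (by omega) fun σ hσ D hD => ?_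
    rcases Finset.mem_insert.1 hD with rfl | hD
    · exact ⟨l, hl, (hσ _ ha).trans hal⟩
    · exact himp σ (fun m hm => hσ m (hFG hm)) D hD
  | erase hC =>
    exact hH.controlled_of_implies hF (by omega)
      fun σ hσ D hD => himp σ hσ D (Finset.mem_of_mem_erase hD)
  | infer hC =>
    refine hH.controlled_of_implies hF (by omega) fun σ hσ D hD => ?_
    rcases Finset.mem_insert.1 hD with rfl | hD
    · exact hC.sound (himp σ hσ)
    · exact himp σ hσ D hD

theorem card_le_spaceOf {π : List (Config V)} {S : Config V} (hS : S ∈ π) :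
    S.card ≤ spaceOf π := by
  induction π with
  | nil => simp at hS
  | cons T π ih =>
    simp only [spaceOf, List.map_cons, List.foldr_cons]
    rcases List.mem_cons.1 hS with rfl | hS
    · exact le_max_left _ _
    · exact (ih hS).trans (le_max_right _ _)

/-- A property of the head of a chain that is preserved by the steps between its members
holds for all members. -/
theorem forall_mem_of_isChain {α : Type*} {R : α → α → Prop} {P : α → Prop} {L : List α}
    (hL : L.IsChain R) (hhead : ∀ a ∈ L.head?, P a)
    (hstep : ∀ a ∈ L, ∀ b ∈ L, R a b → P a → P b) : ∀ a ∈ L, P a := by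
  induction L with
  | nil => simp
  | cons x L ih =>
    have hx : P x := hhead x (by simp)
    obtain ⟨hxL, hL⟩ := List.isChain_cons.1 hL
    have hrest := ih hL
      (fun a ha => hstep x (by simp) a (by simp [List.mem_of_mem_head? ha]) (hxL a ha) hx)
      (fun a ha b hb => hstep a (by simp [ha]) b (by simp [hb]))
    intro a ha
    rcases List.mem_cons.1 ha with rfl | ha
    · exact hx
    · exact hrest a ha

/-- If an unsatisfiable linear `r`-CNF `φ` has a `(k + r - 1)`-winning
strategy, then every configuration-style Res(⊕) refutation of `φ` has space at least
`k - 1`, i.e. `Space(φ) ≥ k - 1`. -/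
theorem space_lower_bound_of_winning_strategy
    {V : Type} [Fintype V] [DecidableEq V] (φ : LinCNF V) (r k : ℕ)
    (hunsat : Unsat φ) (hr : ∀ C ∈ φ, C.card ≤ r)
    (H : Set (LinSystem V)) (hH : IsWinningStrategy φ (k + r - 1) H)
    (π : List (Config V)) (hπ : IsConfigRefutation φ InferSem π) :
    k - 1 ≤ spaceOf π := by
  by_contra hlt
  obtain ⟨n, rfl⟩ : ∃ n, k = n + 1 := ⟨k - 1, by omega⟩
  have hnr : n + 1 + r - 1 = n + r := by omega
  rw [hnr] at hH
  obtain ⟨hhead, hchain, S, hlast, hempty⟩ := hπ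
  have hcard : ∀ T ∈ π, T.card ≤ n := fun T hT => by
    have := card_le_spaceOf hT
    omega
  have hinit : Controlled H (∅ : Config V) := by
    obtain ⟨F, hF⟩ := hH.1
    exact hH.controlled_of_implies hF (by simp) (by simp)
  obtain ⟨F, hF, -, himp⟩ : Controlled H S :=
    forall_mem_of_isChain hchain
      (fun T hT => by
        rw [hhead, Option.mem_some_iff] at hT
        exact hT ▸ hinit)
      (fun A hA B hB => hH.controlled_step hr (hcard A hA) (hcard B hB)) S
      (List.mem_of_getLast? hlast)
  obtain ⟨C, hC⟩ : ∃ C, C ∈ φ := by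
    by_contra h
    exact hunsat ⟨0, fun C hC => absurd ⟨C, hC⟩ h⟩
  obtain ⟨σ, hσ, -⟩ := hH.2.2.1 F hF C hC
  obtain ⟨l, hl, -⟩ := himp σ hσ _ hempty
  simp at hl
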